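/- Let D ⊂ ℝ² be any convex, open, bounded set such that D ∩ B(0,1) = { u = (u₁,u₂) ∈ B(0,1) : u₁ > u₂⁴ }. For s ∈ ℝ with |s| < 1 let x(s) = (s⁴, s) ∈ ∂D, whose inward unit normal is n(s) = (1, −4s³)/√(1+16s⁶). Then for every M > 0 there exist s ∈ (0,1), linear isometries A, A' of ℝ² with A e₁ = n(0) = e₁ and A' e₁ = n(s), and points y, z ∈ ℝ², such that, setting x = (0,0) and x' = (s⁴, s): x + Ay ∈ D, x' + A'y ∈ D, x + Az ∉ D, x' + A'z ∉ D, and |Λ(x+Ay, x+Az) − Λ(x'+A'y, x'+A'z)| − |x − x'| > M ( |x−x'| + ‖A−A'‖ ) ( |y| + |z| + |y| |y−z| / min( dist(x+Ay, ∂D), dist(x'+A'y, ∂D) ) ). In particular, the Lipschitz-type geometric estimate valid for strongly convex domains fails for this (non-strongly) convex domain. -/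

import Mathlib

open Metric Set Bornology
open scoped RealInnerProductSpace

noncomputable section

/-- `lamT D y z` is the largest `t ∈ [0,1]` such that `y + t • (z - y) ∈ closure D`. -/
def lamT (D : Set (EuclideanSpace ℝ (Fin 2)))
    (y z : EuclideanSpace ℝ (Fin 2)) : ℝ :=
  sSup {t : ℝ | t ∈ Set.Icc (0 : ℝ) 1 ∧ y + t • (z - y) ∈ closure D}

/-- The cutoff map `Λ`. -/
def Lam (D : Set (EuclideanSpace ℝ (Fin 2)))
    (y z : EuclideanSpace ℝ (Fin 2)) : EuclideanSpace ℝ (Fin 2) :=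
  y + lamT D y z • (z - y)

/-- The vector `(a,b) ∈ ℝ²`. -/
def v2 (a b : ℝ) : EuclideanSpace ℝ (Fin 2) :=
  (EuclideanSpace.equiv (Fin 2) ℝ).symm ![a, b]

set_option maxHeartbeats 4000000

local notation "E2" => EuclideanSpace ℝ (Fin 2)

theorem aux_v2_0 (a b : ℝ) : (v2 a b) 0 = a := by simp [v2]

theorem aux_v2_1 (a b : ℝ) : (v2 a b) 1 = b := by simp [v2]

theorem aux_norm_sq (u : E2) : ‖u‖ ^ 2 = u 0 ^ 2 + u 1 ^ 2 := by
  rw [EuclideanSpace.norm_sq_eq]; simp [Fin.sum_univ_two]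

theorem aux_norm_le (u : E2) (r : ℝ) (hr : 0 ≤ r) (h : u 0 ^ 2 + u 1 ^ 2 ≤ r ^ 2) : ‖u‖ ≤ r := by
  apply le_of_sq_le_sq _ hr
  rw [aux_norm_sq]; exact h

theorem aux_abs0 (u : E2) : |u 0| ≤ ‖u‖ := by
  apply abs_le_of_sq_le_sq _ (norm_nonneg _)
  rw [aux_norm_sq]; nlinarith [sq_nonneg (u 1)]

theorem aux_abs1 (u : E2) : |u 1| ≤ ‖u‖ := by
  apply abs_le_of_sq_le_sq _ (norm_nonneg _)
  rw [aux_norm_sq]; nlinarith [sq_nonneg (u 0)]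

theorem aux_norm_lt (u : E2) (h0 : |u 0| ≤ 1/2) (h1 : |u 1| ≤ 1/2) : ‖u‖ < 1 := by
  have h : ‖u‖ ≤ 9/10 := by
    apply aux_norm_le _ _ (by norm_num)
    have := sq_le_sq' (abs_le.1 h0).1 (abs_le.1 h0).2
    have := sq_le_sq' (abs_le.1 h1).1 (abs_le.1 h1).2
    linarith
  linarith

/-- rotation -/
def auxRot (c σ : ℝ) (h : c ^ 2 + σ ^ 2 = 1) : E2 →ₗᵢ[ℝ] E2 where
  toFun v := v2 (c * v 0 + σ * v 1) (-σ * v 0 + c * v 1)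
  map_add' u v := by
    ext i; fin_cases i <;> simp [v2] <;> ring
  map_smul' a v := by
    ext i; fin_cases i <;> simp [v2] <;> ring
  norm_map' v := by
    have : ‖v2 (c * v 0 + σ * v 1) (-σ * v 0 + c * v 1)‖ ^ 2 = ‖v‖ ^ 2 := by
      rw [aux_norm_sq, aux_norm_sq, aux_v2_0, aux_v2_1]
      linear_combination (v 0 ^ 2 + v 1 ^ 2) * h
    exact (sq_eq_sq₀ (norm_nonneg _) (norm_nonneg _)).1 this

theorem auxRot_0 (c σ : ℝ) (h : c ^ 2 + σ ^ 2 = 1) (v : E2) :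
    auxRot c σ h v 0 = c * v 0 + σ * v 1 := aux_v2_0 _ _

theorem auxRot_1 (c σ : ℝ) (h : c ^ 2 + σ ^ 2 = 1) (v : E2) :
    auxRot c σ h v 1 = -σ * v 0 + c * v 1 := aux_v2_1 _ _

theorem aux_infDist (D : Set E2) (hop : IsOpen D) (hf : (frontier D).Nonempty) (p : E2) (ρ : ℝ)
    (hb : ∀ u, ‖u - p‖ < ρ → u ∈ D) : ρ ≤ Metric.infDist p (frontier D) := by
  rw [Metric.le_infDist hf]
  intro y hy
  by_contra hlt
  push Not at hlt
  rw [dist_comm, dist_eq_norm] at hlt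
  rw [hop.frontier_eq] at hy
  exact hy.2 (hb y hlt)

theorem aux_real (s : ℝ) (hs : 0 < s) (hs1 : s ≤ 1/10) :
    ∃ c σ : ℝ, c = (Real.sqrt (1 + 16 * s ^ 6))⁻¹ ∧ σ = 4 * s ^ 3 * c ∧ c ^ 2 + σ ^ 2 = 1 ∧
      c ≤ 1 ∧ 1 - 8 * s ^ 6 ≤ c := by
  have h6 : 0 < s ^ 6 := by positivity
  have hr : Real.sqrt (1 + 16 * s ^ 6) ^ 2 = 1 + 16 * s ^ 6 := Real.sq_sqrt (by positivity)
  have hrp : 0 < Real.sqrt (1 + 16 * s ^ 6) := Real.sqrt_pos.2 (by positivity)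
  set r := Real.sqrt (1 + 16 * s ^ 6) with hrdef
  have hr1 : 1 ≤ r := by nlinarith
  have hr2 : r ≤ 1 + 8 * s ^ 6 := by nlinarith [sq_nonneg (s^6)]
  refine ⟨r⁻¹, 4 * s ^ 3 * r⁻¹, rfl, rfl, ?_, inv_le_one_of_one_le₀ hr1, ?_⟩
  · field_simp
    rw [hr]; ring
  · rw [← one_div, le_div_iff₀ hrp]
    rcases le_or_gt (1 - 8 * s^6) 0 with h | h
    · nlinarith
    · nlinarith [sq_nonneg (s^6)]

/-- for any convex open bounded `D ⊂ ℝ²` with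
`D ∩ B(0,1) = {u ∈ B(0,1) : u₁ > u₂⁴}`, the Lipschitz-type geometric estimate valid for
strongly convex domains fails: for every `M > 0` there are `s ∈ (0,1)`, isometries
`A, A'` with `A e₁ = e₁ = n(0)` and `A' e₁ = n(s) = (1,−4s³)/√(1+16s⁶)` (the inward
normals at `x = (0,0)` and `x' = (s⁴,s)`), and points `y, z ∈ ℝ²` with
`x+Ay ∈ D`, `x'+A'y ∈ D`, `x+Az ∉ D`, `x'+A'z ∉ D`, such that
`|Λ(x+Ay,x+Az) − Λ(x'+A'y,x'+A'z)| − |x−x'|`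
`  > M (|x−x'| + ‖A−A'‖)(|y| + |z| + |y||y−z| / min(dist(x+Ay,∂D), dist(x'+A'y,∂D)))`. -/
theorem stmt_9 (D : Set (EuclideanSpace ℝ (Fin 2)))
    (hop : IsOpen D) (hbd : IsBounded D) (hconv : Convex ℝ D)
    (hcap : D ∩ Metric.ball (0 : EuclideanSpace ℝ (Fin 2)) 1 =
      {u : EuclideanSpace ℝ (Fin 2) | u ∈ Metric.ball (0 : EuclideanSpace ℝ (Fin 2)) 1 ∧
        (⟪u, v2 0 1⟫ : ℝ) ^ 4 < ⟪u, v2 1 0⟫}) :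
    ∀ M : ℝ, 0 < M → ∃ s : ℝ, s ∈ Set.Ioo (0 : ℝ) 1 ∧
      ∃ A A' : EuclideanSpace ℝ (Fin 2) →ₗᵢ[ℝ] EuclideanSpace ℝ (Fin 2),
      ∃ y z : EuclideanSpace ℝ (Fin 2),
        A (v2 1 0) = v2 1 0 ∧
        A' (v2 1 0) = (Real.sqrt (1 + 16 * s ^ 6))⁻¹ • v2 1 (-4 * s ^ 3) ∧
        (0 : EuclideanSpace ℝ (Fin 2)) + A y ∈ D ∧
        v2 (s ^ 4) s + A' y ∈ D ∧
        (0 : EuclideanSpace ℝ (Fin 2)) + A z ∉ D ∧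
        v2 (s ^ 4) s + A' z ∉ D ∧
        M * ((‖(0 : EuclideanSpace ℝ (Fin 2)) - v2 (s ^ 4) s‖ +
              ‖A.toContinuousLinearMap - A'.toContinuousLinearMap‖) *
            (‖y‖ + ‖z‖ + ‖y‖ * ‖y - z‖ /
              min (Metric.infDist ((0 : EuclideanSpace ℝ (Fin 2)) + A y) (frontier D))
                  (Metric.infDist (v2 (s ^ 4) s + A' y) (frontier D))))
          < ‖Lam D ((0 : EuclideanSpace ℝ (Fin 2)) + A y)
                ((0 : EuclideanSpace ℝ (Fin 2)) + A z)
              - Lam D (v2 (s ^ 4) s + A' y) (v2 (s ^ 4) s + A' z)‖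
            - ‖(0 : EuclideanSpace ℝ (Fin 2)) - v2 (s ^ 4) s‖ := by
  intro M hM
  have hmem : ∀ u : EuclideanSpace ℝ (Fin 2), ‖u‖ < 1 → (u ∈ D ↔ u 1 ^ 4 < u 0) := by
    intro u hu
    have hu' : u ∈ Metric.ball (0 : EuclideanSpace ℝ (Fin 2)) 1 := by simpa using hu
    have h := Set.ext_iff.1 hcap u
    have e1 : (⟪u, v2 0 1⟫ : ℝ) = u 1 := by
      simp [v2, PiLp.inner_apply, Fin.sum_univ_two]
    have e0 : (⟪u, v2 1 0⟫ : ℝ) = u 0 := by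
      simp [v2, PiLp.inner_apply, Fin.sum_univ_two]
    simp only [Set.mem_inter_iff, Set.mem_ofPred_eq, hu', true_and, and_true, e1, e0] at h
    exact h
  have hclos : ∀ u : EuclideanSpace ℝ (Fin 2), ‖u‖ < 1 → u ∈ closure D → 0 ≤ u 0 := by
    intro u hu hc
    have hu' : u ∈ Metric.ball (0 : EuclideanSpace ℝ (Fin 2)) 1 := by simpa using hu
    have h1 := Metric.isOpen_ball.inter_closure ⟨hu', hc⟩
    have hcl : IsClosed {u : EuclideanSpace ℝ (Fin 2) | 0 ≤ u 0} :=
      isClosed_le continuous_const (by fun_prop)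
    refine closure_minimal ?_ hcl h1
    rintro w ⟨hw, hwD⟩
    have hw1 : ‖w‖ < 1 := by simpa using hw
    have := (hmem w hw1).1 hwD
    have h4 : 0 ≤ w 1 ^ 4 := by positivity
    exact h4.trans this.le
  obtain ⟨s, hs, hs1, hsM⟩ : ∃ s : ℝ, 0 < s ∧ s ≤ 1/10 ∧ M * s ≤ 1/100 := by
    refine ⟨min (1/10) (1/(100*M)), by positivity, min_le_left _ _, ?_⟩
    calc M * min (1/10) (1/(100*M)) ≤ M * (1/(100*M)) := by gcongr; exact min_le_right _ _
      _ = 1/100 := by field_simp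
  obtain ⟨c, σ, hc, hσ, hcσ, hc1, hc2⟩ := aux_real s hs hs1
  have b2 : s ^ 2 ≤ 1/100 := by nlinarith
  have b3 : s ^ 3 ≤ 1/1000 := by nlinarith
  have p3 : 0 < s ^ 3 := by positivity
  have p4 : 0 < s ^ 4 := by positivity
  have b4 : s ^ 4 ≤ s / 1000 := by nlinarith
  have b6 : s ^ 6 ≤ 1/1000000 := by nlinarith
  have p6 : 0 < s ^ 6 := by positivity
  have hc3 : 99/100 ≤ c := by linarith
  have hσ0 : 0 ≤ σ := by rw [hσ]; positivity
  have hσ1 : σ ≤ 4/1000 := by rw [hσ]; nlinarith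
  have hσs : σ * s = 4 * s ^ 4 * c := by rw [hσ]; ring
  set A' := auxRot c σ hcσ with hA'
  set y : EuclideanSpace ℝ (Fin 2) := v2 (s^4) 0 with hy
  set z : EuclideanSpace ℝ (Fin 2) := v2 (s^4) (-s) with hz
  have y0 : y 0 = s^4 := aux_v2_0 _ _
  have y1 : y 1 = 0 := aux_v2_1 _ _
  have z0 : z 0 = s^4 := aux_v2_0 _ _
  have z1 : z 1 = -s := aux_v2_1 _ _
  set x' : EuclideanSpace ℝ (Fin 2) := v2 (s^4) s with hx'
  have x0 : x' 0 = s^4 := aux_v2_0 _ _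
  have x1 : x' 1 = s := aux_v2_1 _ _
  set Y := x' + A' y with hY
  set Z := x' + A' z with hZ
  have Y0 : Y 0 = s^4 + c * s^4 := by
    simp only [hY, PiLp.add_apply, hA', auxRot_0, y0, y1, x0]; ring
  have Y1 : Y 1 = s - σ * s^4 := by
    simp only [hY, PiLp.add_apply, hA', auxRot_1, y0, y1, x1]; ring
  have Z0 : Z 0 = s^4 + c * s^4 - 4 * s^4 * c := by
    simp only [hZ, PiLp.add_apply, hA', auxRot_0, z0, z1, x0]; rw [← hσs]; ring
  have Z1 : Z 1 = s - σ * s^4 - c * s := by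
    simp only [hZ, PiLp.add_apply, hA', auxRot_1, z0, z1, x1]; ring
  have cs4 : c * s^4 ≤ s^4 := mul_le_of_le_one_left p4.le hc1
  have cs4' : 99/100 * s^4 ≤ c * s^4 := mul_le_mul_of_nonneg_right hc3 p4.le
  have σs4 : σ * s^4 ≤ 4/1000 * s^4 := mul_le_mul_of_nonneg_right hσ1 p4.le
  have σs4' : 0 ≤ σ * s^4 := by positivity
  have cs : c * s ≤ s := mul_le_of_le_one_left hs.le hc1
  have cs' : 99/100 * s ≤ c * s := mul_le_mul_of_nonneg_right hc3 hs.le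
  -- balls
  have ball1 : ∀ u, ‖u - y‖ < s^4/2 → u ∈ D := by
    intro u hu
    have h0 := abs_lt.1 ((aux_abs0 (u - y)).trans_lt hu)
    have h1 := abs_lt.1 ((aux_abs1 (u - y)).trans_lt hu)
    simp only [PiLp.sub_apply, y0, y1] at h0 h1
    have hn : ‖u‖ < 1 := by
      apply aux_norm_lt <;> rw [abs_le] <;> constructor <;> linarith [h0.1, h0.2, h1.1, h1.2]
    rw [hmem u hn]
    have hq : |u 1| ≤ s / 2 := by rw [abs_le]; constructor <;> linarith [h1.1, h1.2]
    have h4 : u 1 ^ 4 ≤ (s/2)^4 := by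
      rw [← (show Even 4 by decide).pow_abs]; gcongr
    have : (s/2)^4 = s^4/16 := by ring
    linarith [h0.1]
  have ball2 : ∀ u, ‖u - Y‖ < s^4/2 → u ∈ D := by
    intro u hu
    have h0 := abs_lt.1 ((aux_abs0 (u - Y)).trans_lt hu)
    have h1 := abs_lt.1 ((aux_abs1 (u - Y)).trans_lt hu)
    simp only [PiLp.sub_apply, Y0, Y1] at h0 h1
    have hn : ‖u‖ < 1 := by
      apply aux_norm_lt <;> rw [abs_le] <;> constructor <;> linarith [h0.1, h0.2, h1.1, h1.2]
    rw [hmem u hn]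
    have hq : |u 1| ≤ 101/100 * s := by rw [abs_le]; constructor <;> linarith [h1.1, h1.2]
    have h4 : u 1 ^ 4 ≤ (101/100 * s)^4 := by
      rw [← (show Even 4 by decide).pow_abs]; gcongr
    have : (101/100 * s)^4 = (101/100)^4 * s^4 := by ring
    have : (101/100 : ℝ)^4 * s^4 ≤ 11/10 * s^4 := by gcongr; norm_num
    linarith [h0.1]
  have hyD : y ∈ D := ball1 y (by simpa using by positivity)
  have hYD : Y ∈ D := ball2 Y (by simpa using by positivity)
  have hzn : ‖z‖ < 1 := by
    apply aux_norm_lt <;> simp only [z0, z1] <;> rw [abs_le] <;> constructor <;> linarith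
  have hzD : z ∉ D := by
    rw [hmem z hzn, z0, z1]
    have : (-s)^4 = s^4 := by ring
    linarith
  have hZn : ‖Z‖ < 1 := by
    apply aux_norm_lt <;> simp only [Z0, Z1] <;> rw [abs_le] <;> constructor <;> linarith
  have hZD : Z ∉ D := by
    intro h
    have := hclos Z hZn (subset_closure h)
    rw [Z0] at this
    linarith
  have hzc : z ∈ closure D := by
    rw [Metric.mem_closure_iff]
    intro ε hε
    have hm : 0 < min (ε/2) (1/4) := by positivity
    set m := min (ε/2) (1/4) with hmdef
    have hm1 : m ≤ ε/2 := min_le_left _ _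
    have hm2 : m ≤ 1/4 := min_le_right _ _
    refine ⟨z + v2 m 0, ?_, ?_⟩
    · have e0 : (z + v2 m 0) 0 = s^4 + m := by simp only [PiLp.add_apply, z0, aux_v2_0]
      have e1 : (z + v2 m 0) 1 = -s := by simp only [PiLp.add_apply, z1, aux_v2_1]; ring
      have hn : ‖z + v2 m 0‖ < 1 := by
        apply aux_norm_lt <;> simp only [e0, e1] <;> rw [abs_le] <;> constructor <;> linarith
      rw [hmem _ hn, e0, e1]
      have : (-s)^4 = s^4 := by ring
      linarith
    · rw [dist_comm, dist_eq_norm, add_sub_cancel_left]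
      have : ‖v2 m 0‖ ≤ m := by
        apply aux_norm_le _ _ hm.le
        rw [aux_v2_0, aux_v2_1]; linarith
      linarith
  have hfr : (frontier D).Nonempty := ⟨z, by rw [hop.frontier_eq]; exact ⟨hzc, hzD⟩⟩
  have d1 := aux_infDist D hop hfr y _ ball1
  have d2 := aux_infDist D hop hfr Y _ ball2
  have hL1 : Lam D y z = z := by
    have : lamT D y z = 1 := by
      apply IsGreatest.csSup_eq
      refine ⟨⟨⟨zero_le_one, le_rfl⟩, by simpa using hzc⟩, fun t ht => ht.1.2⟩
    rw [Lam, this]; simp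
  have hT : lamT D Y Z ≤ 6/10 := by
    apply csSup_le
    · exact ⟨0, ⟨le_rfl, zero_le_one⟩, by simpa using subset_closure hYD⟩
    · rintro t ⟨⟨ht0, ht1⟩, ht⟩
      have e0 : (Y + t • (Z - Y)) 0 = s^4 + c * s^4 - t * (4 * (c * s^4)) := by
        simp only [PiLp.add_apply, PiLp.smul_apply, PiLp.sub_apply, Y0, Z0, smul_eq_mul]; ring
      have e1 : (Y + t • (Z - Y)) 1 = s - σ * s^4 - t * (c * s) := by
        simp only [PiLp.add_apply, PiLp.smul_apply, PiLp.sub_apply, Y1, Z1, smul_eq_mul]; ring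
      have q1 : t * (4 * (c * s^4)) ≤ 1 * (4 * (c * s^4)) := by gcongr
      have q2 : 0 ≤ t * (4 * (c * s^4)) := by positivity
      have q3 : t * (c * s) ≤ 1 * (c * s) := by gcongr
      have q4 : 0 ≤ t * (c * s) := by positivity
      have hn : ‖Y + t • (Z - Y)‖ < 1 := by
        apply aux_norm_lt <;> simp only [e0, e1] <;> rw [abs_le] <;> constructor <;> linarith
      have := hclos _ hn ht
      rw [e0] at this
      by_contra hlt
      push Not at hlt
      have : 6/10 * (4 * (c * s^4)) ≤ t * (4 * (c * s^4)) := by gcongr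
      linarith
  have hLam1 : s * (39/100) ≤ (Lam D Y Z) 1 := by
    have : (Lam D Y Z) 1 = s - σ * s^4 - lamT D Y Z * (c * s) := by
      simp only [Lam, PiLp.add_apply, PiLp.smul_apply, PiLp.sub_apply, Y1, Z1, smul_eq_mul]; ring
    rw [this]
    have : lamT D Y Z * (c * s) ≤ 6/10 * (c * s) := by gcongr
    linarith
  have hdiff : s * (139/100) ≤ ‖z - Lam D Y Z‖ := by
    have := aux_abs1 (z - Lam D Y Z)
    have h2 := neg_abs_le ((z - Lam D Y Z) 1)
    rw [PiLp.sub_apply, z1] at *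
    linarith
  have hxn : ‖(0 : EuclideanSpace ℝ (Fin 2)) - x'‖ ≤ 11/10 * s := by
    rw [zero_sub, norm_neg]
    apply aux_norm_le _ _ (by positivity)
    rw [x0, x1]; nlinarith
  have hyn : ‖y‖ ≤ s^4 := by
    apply aux_norm_le _ _ (by positivity)
    rw [y0, y1]; linarith
  have hzn2 : ‖z‖ ≤ 2 * s := by
    apply aux_norm_le _ _ (by positivity)
    rw [z0, z1]; nlinarith
  have hyz : ‖y - z‖ ≤ s := by
    apply aux_norm_le _ _ (by positivity)
    simp only [PiLp.sub_apply, y0, y1, z0, z1]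
    apply le_of_eq; ring
  have hA : ‖(LinearIsometry.id : EuclideanSpace ℝ (Fin 2) →ₗᵢ[ℝ] EuclideanSpace ℝ (Fin 2)).toContinuousLinearMap - A'.toContinuousLinearMap‖ ≤ s := by
    apply ContinuousLinearMap.opNorm_le_bound _ hs.le
    intro v
    apply aux_norm_le _ _ (by positivity)
    have e : ((LinearIsometry.id : EuclideanSpace ℝ (Fin 2) →ₗᵢ[ℝ] EuclideanSpace ℝ (Fin 2)).toContinuousLinearMap - A'.toContinuousLinearMap) v = v - A' v := rfl
    rw [e, mul_pow, aux_norm_sq]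
    simp only [PiLp.sub_apply, hA', auxRot_0, auxRot_1]
    have h1 : 2 - 2 * c ≤ s^2 := by
      have : s^6 = s^4 * s^2 := by ring
      nlinarith [sq_nonneg s]
    have : (v 0 - (c * v 0 + σ * v 1)) ^ 2 + (v 1 - (-σ * v 0 + c * v 1)) ^ 2
        = (2 - 2 * c) * (v 0 ^ 2 + v 1 ^ 2) := by
      linear_combination (v 0 ^ 2 + v 1 ^ 2) * hcσ
    rw [this]
    gcongr
  refine ⟨s, ⟨hs, by linarith⟩, LinearIsometry.id, A', y, z, rfl, ?_, ?_⟩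
  · rw [← hc]
    ext i
    fin_cases i
    · simp [hA', auxRot_0, v2]
    · simp [hA', auxRot_1, v2, hσ]; ring
  simp only [LinearIsometry.id_apply, zero_add]
  refine ⟨hyD, hYD, hzD, hZD, ?_⟩
  rw [hL1]
  have hmin : s^4/2 ≤ min (Metric.infDist y (frontier D)) (Metric.infDist Y (frontier D)) :=
    le_min d1 d2
  have hfrac : ‖y‖ * ‖y - z‖ / min (Metric.infDist y (frontier D)) (Metric.infDist Y (frontier D))
      ≤ 2 * s := by
    calc _ ≤ s^4 * s / (s^4/2) := by gcongr
      _ = 2 * s := by field_simp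
  have hRHS : M * ((‖(0 : EuclideanSpace ℝ (Fin 2)) - x'‖ +
      ‖(LinearIsometry.id : EuclideanSpace ℝ (Fin 2) →ₗᵢ[ℝ] EuclideanSpace ℝ (Fin 2)).toContinuousLinearMap - A'.toContinuousLinearMap‖) *
      (‖y‖ + ‖z‖ + ‖y‖ * ‖y - z‖ /
        min (Metric.infDist y (frontier D)) (Metric.infDist Y (frontier D))))
      ≤ M * ((11/10 * s + s) * (s + 2 * s + 2 * s)) := by
    have hyn' : ‖y‖ ≤ s := by linarith
    have hmp := (by positivity : (0:ℝ) ≤ s^4/2).trans hmin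
    have hnn := add_nonneg (add_nonneg (norm_nonneg y) (norm_nonneg z))
      (div_nonneg (mul_nonneg (norm_nonneg y) (norm_nonneg (y - z))) hmp)
    gcongr
  have : M * ((11/10 * s + s) * (s + 2 * s + 2 * s)) = (M * s) * (21/2 * s) := by ring
  have : (M * s) * (21/2 * s) ≤ 1/100 * (21/2 * s) := by gcongr
  linarith
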